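/- Let Z be an n×n invertible complex matrix and let D be the (real) Fréchet derivative at Z of the map ρ₂(Z) = (Z*Z # conj(Z*Z))^{1/2}. Then for every n×n complex matrix A: ‖D(A)‖ ≤ β(Z)·cond(Z)·(1 + cond(Z)⁴)·‖A‖. -/

import Mathlib

open Matrix MeasureTheory Real
open scoped Matrix.Norms.L2Operator ComplexOrder

-- `Matrix.PosSemidef.sqrt` as it was defined in the older Mathlib
noncomputable def Matrix.PosSemidef.sqrt {n 𝕜 : Type*} [Fintype n] [RCLike 𝕜] [DecidableEq n]
    {A : Matrix n n 𝕜} (hA : A.PosSemidef) : Matrix n n 𝕜 :=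
  (hA.1.eigenvectorUnitary : Matrix n n 𝕜) *
    diagonal ((fun x : ℝ => (x : 𝕜)) ∘ Real.sqrt ∘ hA.1.eigenvalues) *
    (star hA.1.eigenvectorUnitary : Matrix n n 𝕜)

-- `psqrt M` is the unique positive semidefinite square root of a positive semidefinite matrix
open Classical in
noncomputable def psqrt {n : ℕ} (M : Matrix (Fin n) (Fin n) ℂ) : Matrix (Fin n) (Fin n) ℂ :=
  if h : M.PosSemidef then h.sqrt else 0

-- the geometric mean  A#B = A^{1/2} (A^{-1/2} B A^{-1/2})^{1/2} A^{1/2}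
noncomputable def gm {n : ℕ} (A B : Matrix (Fin n) (Fin n) ℂ) : Matrix (Fin n) (Fin n) ℂ :=
  psqrt A * psqrt ((psqrt A)⁻¹ * B * (psqrt A)⁻¹) * psqrt A

-- entrywise complex conjugate
def mconj {n : ℕ} (M : Matrix (Fin n) (Fin n) ℂ) : Matrix (Fin n) (Fin n) ℂ := Mᴴᵀ

-- smallest eigenvalue of a Hermitian matrix
noncomputable def lmin {n : ℕ} {C : Matrix (Fin n) (Fin n) ℂ} (hC : C.IsHermitian) : ℝ :=
  ⨅ i, hC.eigenvalues i

-- ρ₂(Z) = (Z*Z # conj(Z*Z))^{1/2}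
noncomputable def rho2 {n : ℕ} (Z : Matrix (Fin n) (Fin n) ℂ) : Matrix (Fin n) (Fin n) ℂ :=
  psqrt (gm (Zᴴ * Z) (mconj (Zᴴ * Z)))

-- C_Z = (Z*Z)⁻¹ (Z*Z # conj(Z*Z))
noncomputable def CZ {n : ℕ} (Z : Matrix (Fin n) (Fin n) ℂ) : Matrix (Fin n) (Fin n) ℂ :=
  (Zᴴ * Z)⁻¹ * gm (Zᴴ * Z) (mconj (Zᴴ * Z))

-- β(Z) = ∫₀^∞ ‖exp(-t C_Z)‖² dt
noncomputable def beta {n : ℕ} (Z : Matrix (Fin n) (Fin n) ℂ) : ℝ :=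
  ∫ t in Set.Ioi (0 : ℝ), ‖NormedSpace.exp ((-t) • CZ Z)‖ ^ 2

-- cond(Z) = ‖Z‖ ‖Z⁻¹‖
noncomputable def condNum {n : ℕ} (Z : Matrix (Fin n) (Fin n) ℂ) : ℝ := ‖Z‖ * ‖Z⁻¹‖


lemma psqrt_psd {n : ℕ} {M : Matrix (Fin n) (Fin n) ℂ} (h : M.PosSemidef) :
    (psqrt M).PosSemidef := by
  rw [psqrt, dif_pos h, Matrix.PosSemidef.sqrt]
  have h1 : (diagonal ((fun x : ℝ => (x : ℂ)) ∘ Real.sqrt ∘ h.1.eigenvalues)).PosSemidef := by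
    apply Matrix.PosSemidef.diagonal
    intro i
    simp [Real.sqrt_nonneg]
  exact h1.mul_mul_conjTranspose_same (h.1.eigenvectorUnitary : Matrix (Fin n) (Fin n) ℂ)

lemma psqrt_sq {n : ℕ} {M : Matrix (Fin n) (Fin n) ℂ} (h : M.PosSemidef) :
    psqrt M * psqrt M = M := by
  rw [psqrt, dif_pos h, Matrix.PosSemidef.sqrt]
  conv_rhs => rw [h.1.spectral_theorem, Unitary.conjStarAlgAut_apply]
  have hU : (star h.1.eigenvectorUnitary : Matrix (Fin n) (Fin n) ℂ) *
      (h.1.eigenvectorUnitary : Matrix (Fin n) (Fin n) ℂ) = 1 := Unitary.coe_star_mul_self _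
  have hd : diagonal ((fun x : ℝ => (x : ℂ)) ∘ Real.sqrt ∘ h.1.eigenvalues) *
      diagonal ((fun x : ℝ => (x : ℂ)) ∘ Real.sqrt ∘ h.1.eigenvalues) =
      diagonal (RCLike.ofReal ∘ h.1.eigenvalues) := by
    rw [diagonal_mul_diagonal]
    congr 1
    ext i
    simp only [Function.comp]
    rw [← Complex.ofReal_mul, Real.mul_self_sqrt (h.eigenvalues_nonneg i)]
    rfl
  rw [← hd]
  simp only [mul_assoc]
  rw [← mul_assoc (star h.1.eigenvectorUnitary : Matrix (Fin n) (Fin n) ℂ)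
    (h.1.eigenvectorUnitary : Matrix (Fin n) (Fin n) ℂ), hU, one_mul]
  rfl

lemma gm_psd {n : ℕ} {A B : Matrix (Fin n) (Fin n) ℂ} (hA : A.PosSemidef) (hB : B.PosSemidef) :
    (gm A B).PosSemidef := by
  have hS := psqrt_psd hA
  have hSi := hS.inv
  have h1 : ((psqrt A)⁻¹ * B * (psqrt A)⁻¹).PosSemidef := by
    have := hB.mul_mul_conjTranspose_same (psqrt A)⁻¹
    rwa [hSi.1.eq] at this
  have := (psqrt_psd h1).mul_mul_conjTranspose_same (psqrt A)
  rwa [hS.1.eq] at this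

lemma gm_riccati {n : ℕ} {A B : Matrix (Fin n) (Fin n) ℂ} (hA : A.PosDef) (hB : B.PosSemidef) :
    gm A B * A⁻¹ * gm A B = B := by
  have hS := psqrt_psd hA.posSemidef
  have hSi := hS.inv
  have hsq := psqrt_sq hA.posSemidef
  have h1 : ((psqrt A)⁻¹ * B * (psqrt A)⁻¹).PosSemidef := by
    have := hB.mul_mul_conjTranspose_same (psqrt A)⁻¹
    rwa [hSi.1.eq] at this
  have hT := psqrt_sq h1
  have hu : IsUnit (psqrt A) := by
    have := hA.isUnit
    rw [Matrix.isUnit_iff_isUnit_det] at this ⊢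
    rw [← hsq, det_mul] at this
    exact isUnit_of_mul_isUnit_left this
  rw [Matrix.isUnit_iff_isUnit_det] at hu
  unfold gm
  set S := psqrt A with hSdef
  set T := psqrt (S⁻¹ * B * S⁻¹)
  have e1 : S * A⁻¹ * S = 1 := by
    rw [← hsq, Matrix.mul_inv_rev, ← mul_assoc, Matrix.mul_nonsing_inv _ hu, one_mul,
      Matrix.nonsing_inv_mul _ hu]
  calc S * T * S * A⁻¹ * (S * T * S) = S * T * (S * A⁻¹ * S) * T * S := by noncomm_ring
    _ = S * (T * T) * S := by rw [e1]; noncomm_ring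
    _ = (S * S⁻¹) * B * (S⁻¹ * S) := by rw [hT]; noncomm_ring
    _ = B := by rw [Matrix.mul_nonsing_inv _ hu, Matrix.nonsing_inv_mul _ hu]; simp

lemma norm_mconj_le {n : ℕ} (M : Matrix (Fin n) (Fin n) ℂ) : ‖mconj M‖ ≤ ‖M‖ := by
  rw [← l2_opNorm_toEuclideanCLM (mconj M)]
  refine ContinuousLinearMap.opNorm_le_bound _ (norm_nonneg _) fun x => ?_
  have h := l2_opNorm_mulVec M (WithLp.toLp 2 (star (WithLp.ofLp x)))
  have e1 : ‖(WithLp.toLp 2 (star (WithLp.ofLp x)) : EuclideanSpace ℂ (Fin n))‖ = ‖x‖ := by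
    simp [EuclideanSpace.norm_eq]
  have e2 : ‖(EuclideanSpace.equiv (Fin n) ℂ).symm (M *ᵥ (star (WithLp.ofLp x)))‖ =
      ‖toEuclideanCLM (n := Fin n) (𝕜 := ℂ) (mconj M) x‖ := by
    rw [EuclideanSpace.norm_eq, EuclideanSpace.norm_eq]
    congr 1
    refine Finset.sum_congr rfl fun i _ => ?_
    congr 1
    rw [← norm_star]
    congr 1
    simp [mconj, mulVec, dotProduct, mul_comm]
  rw [e1] at h
  rw [← e2]
  exact h

lemma mconj_mconj {n : ℕ} (M : Matrix (Fin n) (Fin n) ℂ) : mconj (mconj M) = M := by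
  ext i j; simp [mconj]

lemma norm_mconj {n : ℕ} (M : Matrix (Fin n) (Fin n) ℂ) : ‖mconj M‖ = ‖M‖ := by
  refine le_antisymm (norm_mconj_le M) ?_
  have := norm_mconj_le (mconj M)
  rwa [mconj_mconj] at this

lemma norm_unitary_conj_le {n : ℕ} (U : unitary (Matrix (Fin n) (Fin n) ℂ))
    (M : Matrix (Fin n) (Fin n) ℂ) :
    ‖(U : Matrix (Fin n) (Fin n) ℂ) * M * star (U : Matrix (Fin n) (Fin n) ℂ)‖ = ‖M‖ := by
  rw [← Unitary.coe_star, CStarRing.norm_mul_coe_unitary, CStarRing.norm_coe_unitary_mul]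

lemma exp_bound {n : ℕ} {X : Matrix (Fin n) (Fin n) ℂ} (hX : X.PosDef) (t : ℝ) (ht : 0 ≤ t) :
    ‖NormedSpace.exp ((-t) • X)‖ ≤ Real.exp (-(t / ‖X⁻¹‖)) := by
  set U := hX.1.eigenvectorUnitary with hU
  set lam := hX.1.eigenvalues with hlam
  have hs : X = (U : Matrix (Fin n) (Fin n) ℂ) * diagonal (fun i => (lam i : ℂ)) *
      star (U : Matrix (Fin n) (Fin n) ℂ) := by
    have := hX.1.spectral_theorem
    rw [Unitary.conjStarAlgAut_apply] at this
    exact this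
  have hUU : star (U : Matrix (Fin n) (Fin n) ℂ) * (U : Matrix (Fin n) (Fin n) ℂ) = 1 :=
    Unitary.coe_star_mul_self _
  have hUU' : (U : Matrix (Fin n) (Fin n) ℂ) * star (U : Matrix (Fin n) (Fin n) ℂ) = 1 :=
    Unitary.coe_mul_star_self _
  have hpos : ∀ i, 0 < lam i := fun i => hX.eigenvalues_pos i
  have hUinv : (U : Matrix (Fin n) (Fin n) ℂ)⁻¹ = star (U : Matrix (Fin n) (Fin n) ℂ) :=
    Matrix.inv_eq_left_inv hUU
  have hUunit : IsUnit (U : Matrix (Fin n) (Fin n) ℂ) := IsUnit.of_mul_eq_one _ hUU'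
  have hinv : X⁻¹ = (U : Matrix (Fin n) (Fin n) ℂ) * diagonal (fun i => ((lam i)⁻¹ : ℂ)) *
      star (U : Matrix (Fin n) (Fin n) ℂ) := by
    apply Matrix.inv_eq_left_inv
    conv_lhs => rw [hs]
    have hd : diagonal (fun i => ((lam i)⁻¹ : ℂ)) * diagonal (fun i => (lam i : ℂ)) = 1 := by
      rw [diagonal_mul_diagonal, ← diagonal_one]
      congr 1
      ext i
      have : (lam i : ℂ) ≠ 0 := by exact_mod_cast (hpos i).ne'
      simp [this]
    calc _ = (U : Matrix (Fin n) (Fin n) ℂ) * diagonal (fun i => ((lam i)⁻¹ : ℂ)) *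
        (star (U : Matrix (Fin n) (Fin n) ℂ) * (U : Matrix (Fin n) (Fin n) ℂ)) *
        diagonal (fun i => (lam i : ℂ)) * star (U : Matrix (Fin n) (Fin n) ℂ) := by noncomm_ring
      _ = (U : Matrix (Fin n) (Fin n) ℂ) * (diagonal (fun i => ((lam i)⁻¹ : ℂ)) *
        diagonal (fun i => (lam i : ℂ))) * star (U : Matrix (Fin n) (Fin n) ℂ) := by
          rw [hUU]; noncomm_ring
      _ = 1 := by rw [hd, mul_one, hUU']
  have hexp : NormedSpace.exp ((-t) • X) = (U : Matrix (Fin n) (Fin n) ℂ) *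
      diagonal (NormedSpace.exp (fun i => ((-t * lam i : ℝ) : ℂ))) *
      star (U : Matrix (Fin n) (Fin n) ℂ) := by
    rw [← Matrix.exp_diagonal, ← hUinv, ← Matrix.exp_conj _ _ hUunit, hUinv]
    congr 1
    conv_lhs => rw [hs]
    have : diagonal (fun i => ((-t * lam i : ℝ) : ℂ)) = (-t) • diagonal (fun i => (lam i : ℂ)) := by
      ext i j
      by_cases h : i = j
      · subst h; simp
      · simp [h]
    rw [this]
    simp
  rw [hexp, norm_unitary_conj_le, hinv, norm_unitary_conj_le, l2_opNorm_diagonal,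
    l2_opNorm_diagonal]
  refine (pi_norm_le_iff_of_nonneg (Real.exp_pos _).le).2 fun i => ?_
  rw [Pi.coe_exp, ← Complex.exp_eq_exp_ℂ, Complex.norm_exp, Complex.ofReal_re]
  apply Real.exp_le_exp.2
  have h1 : (lam i)⁻¹ ≤ ‖fun i => ((lam i)⁻¹ : ℂ)‖ := by
    have := norm_le_pi_norm (fun i => ((lam i)⁻¹ : ℂ)) i
    simpa [abs_of_pos (hpos i)] using this
  have h2 : 1 / ‖fun i => ((lam i)⁻¹ : ℂ)‖ ≤ lam i := by
    rw [one_div]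
    exact inv_le_of_inv_le₀ (hpos i) h1
  have h3 := mul_le_mul_of_nonneg_left h2 ht
  rw [mul_one_div] at h3
  linarith

open Filter Topology in
lemma sylv {n : ℕ} {C H : Matrix (Fin n) (Fin n) ℂ} {c μ : ℝ} (hμ : 0 < μ)
    (hb : ∀ t : ℝ, 0 ≤ t → ‖NormedSpace.exp ((-t) • C)‖ ≤ c * Real.exp (-(μ * t))) :
    ‖H‖ ≤ (∫ t in Set.Ioi (0 : ℝ), ‖NormedSpace.exp ((-t) • C)‖ ^ 2) * ‖H * C + Cᴴ * H‖ := by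
  set E : ℝ → Matrix (Fin n) (Fin n) ℂ := fun t => NormedSpace.exp ((-t) • C) with hE
  set Y := H * C + Cᴴ * H with hY
  have hEd : ∀ t, HasDerivAt E (-(C * E t)) t := by
    intro t
    have := hasDerivAt_exp_smul_const' (𝕂 := ℝ) (-C) t
    simpa [hE] using this
  have hEc : Continuous E := continuous_iff_continuousAt.2 fun t => (hEd t).continuousAt
  have hESd : ∀ t, HasDerivAt (fun t => (E t)ᴴ) (-((E t)ᴴ * Cᴴ)) t := by
    intro t
    have := (hEd t).star
    simpa [Matrix.star_eq_conjTranspose] using this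
  have hFd : ∀ t, HasDerivAt (fun t => (E t)ᴴ * H * E t) (-((E t)ᴴ * Y * E t)) t := by
    intro t
    have := ((hESd t).mul_const H).mul (hEd t)
    have e : -((E t)ᴴ * Y * E t) =
        -((E t)ᴴ * Cᴴ) * H * E t + (E t)ᴴ * H * -(C * E t) := by
      rw [hY]; noncomm_ring
    rw [e]
    exact this
  have hnS : ∀ t, ‖(E t)ᴴ‖ = ‖E t‖ := fun t => l2_opNorm_conjTranspose _
  have hsq : ∀ t : ℝ, 0 ≤ t → ‖E t‖ ^ 2 ≤ c ^ 2 * Real.exp (-(2 * μ) * t) := by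
    intro t ht
    have := pow_le_pow_left₀ (norm_nonneg _) (hb t ht) 2
    refine this.trans (le_of_eq ?_)
    rw [mul_pow, ← Real.exp_nat_mul]
    congr 2
    push_cast; ring
  have hmaj : IntegrableOn (fun t : ℝ => c ^ 2 * Real.exp (-(2 * μ) * t)) (Set.Ioi 0) :=
    (integrableOn_exp_mul_Ioi (by linarith) 0).const_mul _
  have hint : IntegrableOn (fun t => ‖E t‖ ^ 2) (Set.Ioi 0) := by
    refine Integrable.mono' hmaj (by fun_prop) ?_
    filter_upwards [ae_restrict_mem measurableSet_Ioi] with t ht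
    rw [Real.norm_of_nonneg (by positivity)]
    exact hsq t (le_of_lt ht)
  have hbd : ∀ (M : Matrix (Fin n) (Fin n) ℂ) t, ‖(E t)ᴴ * M * E t‖ ≤ ‖E t‖ ^ 2 * ‖M‖ := by
    intro M t
    calc _ ≤ ‖(E t)ᴴ‖ * ‖M‖ * ‖E t‖ := norm_mul₃_le
      _ = _ := by rw [hnS]; ring
  have hESc : Continuous (fun t => (E t)ᴴ) :=
    continuous_iff_continuousAt.2 fun t => (hESd t).continuousAt
  have hint2 : IntegrableOn (fun t => -((E t)ᴴ * Y * E t)) (Set.Ioi 0) := by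
    refine Integrable.mono' (hint.mul_const ‖Y‖)
      (((hESc.mul continuous_const).mul hEc).neg.aestronglyMeasurable) ?_
    filter_upwards with t
    rw [norm_neg]
    exact hbd Y t
  have hlim : Tendsto (fun t => (E t)ᴴ * H * E t) atTop (𝓝 0) := by
    have h0 : Tendsto (fun t : ℝ => c ^ 2 * Real.exp (-(2 * μ) * t) * ‖H‖) atTop (𝓝 0) := by
      have : Tendsto (fun t : ℝ => Real.exp (-(2 * μ) * t)) atTop (𝓝 0) := by
        apply Real.tendsto_exp_atBot.comp
        exact tendsto_id.const_mul_atTop_of_neg (by linarith)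
      simpa using (this.const_mul (c ^ 2)).mul_const ‖H‖
    refine squeeze_zero_norm' ?_ h0
    filter_upwards [eventually_ge_atTop 0] with t ht
    exact (hbd H t).trans (mul_le_mul_of_nonneg_right (hsq t ht) (norm_nonneg _))
  have key := integral_Ioi_of_hasDerivAt_of_tendsto' (fun t _ => hFd t) hint2 hlim
  have hE0 : E 0 = 1 := by simp [hE]
  rw [hE0] at key
  simp only [conjTranspose_one, one_mul, mul_one, zero_sub] at key
  rw [← norm_neg H, ← key, ← integral_mul_const]
  refine norm_integral_le_of_norm_le (hint.mul_const _) ?_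
  filter_upwards with t
  rw [norm_neg]
  exact hbd Y t

lemma gram_posDef {n : ℕ} {W : Matrix (Fin n) (Fin n) ℂ} (hW : IsUnit W) : (Wᴴ * W).PosDef := by
  apply Matrix.PosDef.conjTranspose_mul_self
  exact Matrix.mulVec_injective_iff_isUnit.2 hW

lemma mconj_gram_posDef {n : ℕ} {W : Matrix (Fin n) (Fin n) ℂ} (hW : IsUnit W) :
    (mconj (Wᴴ * W)).PosDef := (gram_posDef hW).conjTranspose.transpose

lemma rho2_psd {n : ℕ} {W : Matrix (Fin n) (Fin n) ℂ} (hW : IsUnit W) :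
    (rho2 W).PosSemidef :=
  psqrt_psd (gm_psd (gram_posDef hW).posSemidef (mconj_gram_posDef hW).posSemidef)

lemma rho2_sq {n : ℕ} {W : Matrix (Fin n) (Fin n) ℂ} (hW : IsUnit W) :
    rho2 W * rho2 W = gm (Wᴴ * W) (mconj (Wᴴ * W)) :=
  psqrt_sq (gm_psd (gram_posDef hW).posSemidef (mconj_gram_posDef hW).posSemidef)

lemma rho2_riccati {n : ℕ} {W : Matrix (Fin n) (Fin n) ℂ} (hW : IsUnit W) :
    (rho2 W * rho2 W) * (Wᴴ * W)⁻¹ * (rho2 W * rho2 W) = mconj (Wᴴ * W) := by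
  rw [rho2_sq hW]
  exact gm_riccati (gram_posDef hW) (mconj_gram_posDef hW).posSemidef

lemma rho2_posDef {n : ℕ} {W : Matrix (Fin n) (Fin n) ℂ} (hW : IsUnit W) :
    (rho2 W).PosDef := by
  rw [(rho2_psd hW).posDef_iff_isUnit]
  have h := (mconj_gram_posDef hW).isUnit
  rw [← rho2_riccati hW] at h
  rw [Matrix.isUnit_iff_isUnit_det] at h ⊢
  rw [det_mul, det_mul (rho2 W) (rho2 W)] at h
  exact isUnit_of_mul_isUnit_left (isUnit_of_mul_isUnit_right h)

/-- the real-linear continuous map `mconj` -/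
noncomputable def mconjL (n : ℕ) :
    Matrix (Fin n) (Fin n) ℂ →L[ℝ] Matrix (Fin n) (Fin n) ℂ :=
  LinearMap.toContinuousLinearMap
    { toFun := mconj
      map_add' := fun x y => by ext i j; simp [mconj]
      map_smul' := fun c x => by ext i j; simp [mconj] }

lemma mconj_inv {n : ℕ} (M : Matrix (Fin n) (Fin n) ℂ) : (mconj M)⁻¹ = mconj M⁻¹ := by
  rw [mconj, mconj, ← Matrix.transpose_nonsing_inv, Matrix.conjTranspose_nonsing_inv]

lemma rho2_deriv_eq {n : ℕ} {Z : Matrix (Fin n) (Fin n) ℂ} (hZ : IsUnit Z)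
    {D : Matrix (Fin n) (Fin n) ℂ →L[ℝ] Matrix (Fin n) (Fin n) ℂ}
    (hD : HasFDerivAt (rho2 (n := n)) D Z) (A : Matrix (Fin n) (Fin n) ℂ) :
    (D A * rho2 Z + rho2 Z * D A) * CZ Z + (CZ Z)ᴴ * (D A * rho2 Z + rho2 Z * D A) =
      mconj (Aᴴ * Z + Zᴴ * A) + (CZ Z)ᴴ * (Aᴴ * Z + Zᴴ * A) * CZ Z := by
  have hl : HasDerivAt (fun s : ℝ => Z + s • A) A 0 := by
    have := ((hasDerivAt_id (0 : ℝ)).smul_const A).const_add Z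
    simpa using this
  have hl0 : Z + (0 : ℝ) • A = Z := by simp
  have hr : HasDerivAt (fun s : ℝ => rho2 (Z + s • A)) (D A) 0 :=
    hD.comp_hasDerivAt_of_eq 0 hl hl0.symm
  have hls : HasDerivAt (fun s : ℝ => (Z + s • A)ᴴ) Aᴴ 0 := hl.star
  have hP : HasDerivAt (fun s : ℝ => (Z + s • A)ᴴ * (Z + s • A)) (Aᴴ * Z + Zᴴ * A) 0 := by
    have := hls.mul hl
    rw [hl0] at this
    exact this
  have hQ : HasDerivAt (fun s : ℝ => mconj ((Z + s • A)ᴴ * (Z + s • A)))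
      (mconj (Aᴴ * Z + Zᴴ * A)) 0 :=
    (mconjL n).hasFDerivAt.comp_hasDerivAt 0 hP
  have hPd := gram_posDef hZ
  obtain ⟨u, hu⟩ := hPd.isUnit
  have hui : ((u⁻¹ : (Matrix (Fin n) (Fin n) ℂ)ˣ) : Matrix (Fin n) (Fin n) ℂ) = (Zᴴ * Z)⁻¹ := by
    rw [Matrix.coe_units_inv, hu]
  have hR : HasDerivAt (fun s : ℝ => ((Z + s • A)ᴴ * (Z + s • A))⁻¹)
      (-((Zᴴ * Z)⁻¹ * (Aᴴ * Z + Zᴴ * A) * (Zᴴ * Z)⁻¹)) 0 := by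
    have h1 := (hasFDerivAt_ringInverse (𝕜 := ℝ) u).comp_hasDerivAt_of_eq 0 hP
      (by rw [hu, hl0])
    simp only [hui] at h1
    simp_rw [Matrix.nonsing_inv_eq_ringInverse] at h1 ⊢
    simpa using! h1
  have hg := hr.mul hr
  have hL := (hg.mul hR).mul hg
  have hev : ∀ᶠ s : ℝ in nhds 0, IsUnit (Z + s • A) := by
    have hc : ContinuousAt (fun s : ℝ => Z + s • A) 0 := hl.continuousAt
    apply hc.eventually
    simp only [hl0]
    exact Units.isOpen.mem_nhds hZ
  have hQ' := hQ.congr_of_eventuallyEq (f₁ := (fun s : ℝ =>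
      (rho2 (Z + s • A) * rho2 (Z + s • A)) * ((Z + s • A)ᴴ * (Z + s • A))⁻¹ *
      (rho2 (Z + s • A) * rho2 (Z + s • A)))) (by
    filter_upwards [hev] with s hs
    exact rho2_riccati hs)
  have huniq := hQ'.unique hL
  simp only [Pi.mul_apply, hl0] at huniq
  have hC : CZ Z = (Zᴴ * Z)⁻¹ * (rho2 Z * rho2 Z) := by rw [CZ, rho2_sq hZ]
  have hCs : (CZ Z)ᴴ = (rho2 Z * rho2 Z) * (Zᴴ * Z)⁻¹ := by
    rw [hC, conjTranspose_mul, conjTranspose_mul, (rho2_psd hZ).1.eq, hPd.inv.1.eq]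
  rw [huniq, hCs, hC]
  noncomm_ring

lemma scalar_aux1 {k p q a b : ℝ} (hk : 1 ≤ k) (h1 : p ≤ 2 * a * b)
    (h2 : q ≤ k * (2 * a * b) * k) (h3 : 0 ≤ 2 * a * b := by positivity) :
    p + q ≤ 2 * a * b * (1 + k ^ 4) := by
  have h4 : k ^ 2 ≤ k ^ 4 := pow_le_pow_right₀ hk (by norm_num)
  nlinarith [mul_le_mul_of_nonneg_left h4 h3]

lemma scalar_aux2 {d x z zi h b y a k : ℝ} (hx0 : 0 ≤ x) (hh : 0 ≤ h) (hb : 0 ≤ b)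
    (hx : x ≤ zi) (h1 : d ≤ x / 2 * h) (h2 : h ≤ b * y) (h3 : y ≤ 2 * z * a * (1 + k ^ 4))
    (hk : k = z * zi) :
    d ≤ b * k * (1 + k ^ 4) * a := by
  have h4 := h2.trans (mul_le_mul_of_nonneg_left h3 hb)
  have h5 : x / 2 * h ≤ zi / 2 * (b * (2 * z * a * (1 + k ^ 4))) :=
    mul_le_mul (by linarith) h4 hh (by linarith)
  calc d ≤ _ := h1.trans h5
    _ = b * (z * zi) * (1 + k ^ 4) * a := by ring
    _ = _ := by rw [← hk]

set_option maxHeartbeats 1000000 in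
theorem stmt8 {n : ℕ} (hn : 0 < n) (Z : Matrix (Fin n) (Fin n) ℂ) (hZ : IsUnit Z)
    (D : Matrix (Fin n) (Fin n) ℂ →L[ℝ] Matrix (Fin n) (Fin n) ℂ)
    (hD : HasFDerivAt (rho2 (n := n)) D Z) :
    ∀ A : Matrix (Fin n) (Fin n) ℂ,
      ‖D A‖ ≤ beta Z * condNum Z * (1 + condNum Z ^ 4) * ‖A‖ := by
  intro A
  have : Nonempty (Fin n) := ⟨⟨0, hn⟩⟩
  have hder := rho2_deriv_eq hZ hD A
  have hX := rho2_posDef hZ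
  have hPd := gram_posDef hZ
  have hXu := hX.isUnit
  have hXd := (Matrix.isUnit_iff_isUnit_det _).1 hXu
  have hZd := (Matrix.isUnit_iff_isUnit_det _).1 hZ
  have hric := rho2_riccati hZ
  have hC : CZ Z = (Zᴴ * Z)⁻¹ * (rho2 Z * rho2 Z) := by rw [CZ, rho2_sq hZ]
  set X := rho2 Z with hXdef
  have hXs : Xᴴ = X := hX.1.eq
  set H := D A * X + X * D A with hH
  set V := (Zᴴ)⁻¹ * (X * X) with hV
  clear_value H V X
  have hPinv : (Zᴴ * Z)⁻¹ = Z⁻¹ * (Zᴴ)⁻¹ := Matrix.mul_inv_rev _ _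
  have hCV : CZ Z = Z⁻¹ * V := by rw [hC, hPinv, mul_assoc, hV]
  have hVs : Vᴴ = (X * X) * Z⁻¹ := by
    rw [hV, conjTranspose_mul, conjTranspose_mul, hXs, Matrix.conjTranspose_nonsing_inv,
      conjTranspose_conjTranspose]
  have hVV : Vᴴ * V = mconj (Zᴴ * Z) := by
    rw [hVs, ← hric, hPinv, hV]; noncomm_ring
  have hVn : ‖V‖ = ‖Z‖ := by
    have h1 := l2_opNorm_conjTranspose_mul_self V
    rw [hVV, norm_mconj, l2_opNorm_conjTranspose_mul_self] at h1
    exact ((mul_self_inj (norm_nonneg Z) (norm_nonneg V)).1 h1).symm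
  have hZ1 : Z * Z⁻¹ = 1 := Matrix.mul_nonsing_inv _ hZd
  have hXX : X * X⁻¹ = 1 := Matrix.mul_nonsing_inv _ hXd
  have hXX' : X⁻¹ * X = 1 := Matrix.nonsing_inv_mul _ hXd
  -- condition number
  have hk1 : 1 ≤ condNum Z := by
    have h1 : ‖(1 : Matrix (Fin n) (Fin n) ℂ)‖ = 1 := norm_one
    rw [← h1, ← hZ1]
    exact norm_mul_le _ _
  have hCn : ‖CZ Z‖ ≤ condNum Z := by
    rw [hCV]
    refine (norm_mul_le _ _).trans (le_of_eq ?_)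
    rw [hVn, condNum, mul_comm]
  -- inverse of X
  have hXi : ‖X⁻¹‖ ≤ ‖Z⁻¹‖ := by
    have h1 : V⁻¹ * (V⁻¹)ᴴ = mconj ((Zᴴ * Z)⁻¹) := by
      rw [← mconj_inv, ← hVV, Matrix.mul_inv_rev Vᴴ V, Matrix.conjTranspose_nonsing_inv]
    have h2 : ‖V⁻¹‖ = ‖Z⁻¹‖ := by
      have h3 := l2_opNorm_conjTranspose_mul_self (V⁻¹)ᴴ
      have h4 := l2_opNorm_conjTranspose_mul_self (Z⁻¹)ᴴ
      rw [conjTranspose_conjTranspose, l2_opNorm_conjTranspose] at h3 h4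
      rw [h1, norm_mconj, hPinv, ← Matrix.conjTranspose_nonsing_inv, h4] at h3
      exact ((mul_self_inj (norm_nonneg _) (norm_nonneg _)).1 h3).symm
    have h5 : X⁻¹ * X⁻¹ = V⁻¹ * (Z⁻¹)ᴴ := by
      have h6 : V⁻¹ = X⁻¹ * X⁻¹ * Zᴴ := by
        rw [hV, Matrix.mul_inv_rev, Matrix.mul_inv_rev, Matrix.nonsing_inv_nonsing_inv]
        rw [Matrix.det_conjTranspose]
        exact hZd.star
      have h7 : Zᴴ * (Z⁻¹)ᴴ = 1 := by
        rw [← conjTranspose_mul, Matrix.nonsing_inv_mul _ hZd, conjTranspose_one]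
      rw [h6, mul_assoc _ Zᴴ, h7, mul_one]
    have h8 := l2_opNorm_conjTranspose_mul_self X⁻¹
    rw [hX.inv.1.eq, h5] at h8
    have h9 : ‖X⁻¹‖ * ‖X⁻¹‖ ≤ ‖Z⁻¹‖ * ‖Z⁻¹‖ := by
      rw [← h8]
      refine (norm_mul_le _ _).trans (le_of_eq ?_)
      rw [l2_opNorm_conjTranspose, h2]
    exact (mul_self_le_mul_self_iff (norm_nonneg _) (norm_nonneg _)).2 h9
  have hXipos : 0 < ‖X⁻¹‖ := norm_pos_iff.2 fun h => by
    rw [h, mul_zero] at hXX; exact zero_ne_one hXX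
  -- first Sylvester equation
  have hK : (X * (Zᴴ * Z)⁻¹ * X).PosDef := by
    have := hPd.inv.mul_mul_conjTranspose_same (B := X)
      (Matrix.vecMul_injective_iff_isUnit.2 hXu)
    rwa [hXs] at this
  set K := X * (Zᴴ * Z)⁻¹ * X with hKdef
  clear_value K
  have hCK : CZ Z = X⁻¹ * K * X := by
    rw [hC, hKdef]
    calc _ = 1 * (Zᴴ * Z)⁻¹ * (X * X) := by rw [one_mul]
      _ = _ := by rw [← hXX']; noncomm_ring
  have hKipos : 0 < ‖K⁻¹‖ := norm_pos_iff.2 fun h => by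
    have h1 := Matrix.mul_nonsing_inv K ((Matrix.isUnit_iff_isUnit_det _).1 hK.isUnit)
    rw [h, mul_zero] at h1; exact zero_ne_one h1
  have hs1 : ‖H‖ ≤ beta Z * ‖H * CZ Z + (CZ Z)ᴴ * H‖ := by
    have hmu : 0 < 1 / ‖K⁻¹‖ := one_div_pos.2 hKipos
    unfold beta
    refine sylv (c := ‖X⁻¹‖ * ‖X‖) hmu fun t ht => ?_
    have h1 : (-t) • CZ Z = X⁻¹ * ((-t) • K) * X := by rw [hCK]; simp
    rw [h1, Matrix.exp_conj' _ _ hXu]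
    have h2 := exp_bound hK t ht
    have h3 : -(t / ‖K⁻¹‖) = -(1 / ‖K⁻¹‖ * t) := by ring
    rw [h3] at h2
    calc _ ≤ ‖X⁻¹‖ * ‖NormedSpace.exp ((-t) • K)‖ * ‖X‖ := norm_mul₃_le
      _ ≤ ‖X⁻¹‖ * Real.exp (-(1 / ‖K⁻¹‖ * t)) * ‖X‖ := by gcongr
      _ = _ := by ring
  -- second Sylvester equation
  have hs2 : ‖D A‖ ≤ ‖X⁻¹‖ / 2 * ‖H‖ := by
    have hb : ∀ t : ℝ, 0 ≤ t →
        ‖NormedSpace.exp ((-t) • X)‖ ≤ 1 * Real.exp (-(1 / ‖X⁻¹‖ * t)) := by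
      intro t ht
      have h2 := exp_bound hX t ht
      have h3 : -(t / ‖X⁻¹‖) = -(1 / ‖X⁻¹‖ * t) := by ring
      rwa [h3, ← one_mul (Real.exp _)] at h2
    have h1 := sylv (H := D A) (one_div_pos.2 hXipos) hb
    rw [hXs, ← hH] at h1
    refine h1.trans (mul_le_mul_of_nonneg_right ?_ (norm_nonneg _))
    have hneg : -(2 / ‖X⁻¹‖) < 0 := neg_lt_zero.2 (div_pos two_pos hXipos)
    have hval : ∫ t in Set.Ioi (0 : ℝ), Real.exp (-(2 / ‖X⁻¹‖) * t) = ‖X⁻¹‖ / 2 := by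
      rw [integral_exp_mul_Ioi hneg]
      simp
    rw [← hval]
    refine integral_mono_of_nonneg ?_ (integrableOn_exp_mul_Ioi hneg 0) ?_
    · filter_upwards with t
      positivity
    · filter_upwards [ae_restrict_mem measurableSet_Ioi] with t ht
      have := pow_le_pow_left₀ (norm_nonneg _) (hb t (le_of_lt ht)) 2
      refine this.trans (le_of_eq ?_)
      rw [one_mul, ← Real.exp_nat_mul]
      congr 1
      push_cast; ring
  -- right-hand side
  have hPn : ‖Aᴴ * Z + Zᴴ * A‖ ≤ 2 * ‖Z‖ * ‖A‖ := by
    refine (norm_add_le _ _).trans ?_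
    have h1 := norm_mul_le Aᴴ Z
    have h2 := norm_mul_le Zᴴ A
    rw [l2_opNorm_conjTranspose] at h1 h2
    exact (add_le_add h1 h2).trans (le_of_eq (by ring))
  have hY : ‖H * CZ Z + (CZ Z)ᴴ * H‖ ≤ 2 * ‖Z‖ * ‖A‖ * (1 + condNum Z ^ 4) := by
    rw [hder]
    refine (norm_add_le _ _).trans ?_
    rw [norm_mconj]
    have h1 : ‖(CZ Z)ᴴ * (Aᴴ * Z + Zᴴ * A) * CZ Z‖ ≤
        condNum Z * (2 * ‖Z‖ * ‖A‖) * condNum Z := by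
      refine norm_mul₃_le.trans ?_
      rw [l2_opNorm_conjTranspose]
      gcongr
    exact scalar_aux1 hk1 hPn h1
  have hbeta : 0 ≤ beta Z := by
    unfold beta
    exact integral_nonneg fun t => by positivity
  exact scalar_aux2 (norm_nonneg _) (norm_nonneg _) hbeta hXi hs2 hs1 hY rfl
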